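/- Let α : ℝ → ℝ be locally Lipschitz, strictly increasing, and satisfy α(0) = 0. Let c ∈ ℝ, let t0 ≤ T be reals, and let φ : ℝ → ℝ be differentiable on [t0, T] with φ(t0) ≥ c and φ'(t) ≥ −α(φ(t) − c) for all t ∈ [t0, T]. Then φ(t) ≥ c for all t ∈ [t0, T]. -/

import Mathlib

/-- **Scalar comparison/invariance statement (base case of Lemma 1 of the paper).**
If `α` is locally Lipschitz, strictly increasing with `α 0 = 0`, and `φ` is
differentiable on `[t0, T]` with derivative `D` satisfying `D t ≥ -α (φ t - c)`, then
the superlevel set `{φ ≥ c}` is forward invariant: `φ t0 ≥ c` implies `φ t ≥ c` on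
`[t0, T]`. -/
theorem stmt_9
    (α : ℝ → ℝ) (hα_lip : LocallyLipschitz α) (hα_mono : StrictMono α) (hα0 : α 0 = 0)
    (c : ℝ) (t0 T : ℝ) (ht : t0 ≤ T)
    (φ D : ℝ → ℝ)
    (hdiff : ∀ t ∈ Set.Icc t0 T, HasDerivAt φ (D t) t)
    (hinit : φ t0 ≥ c)
    (hineq : ∀ t ∈ Set.Icc t0 T, D t ≥ - α (φ t - c)) :
    ∀ t ∈ Set.Icc t0 T, φ t ≥ c := by
  intro t htT
  refine le_of_forall_pos_le_add fun ε hε => ?_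
  have h_barrier : -φ t ≤ -c + ε := by
    refine image_le_of_deriv_right_lt_deriv_boundary (f := fun s => -φ s)
      (f' := fun s => -D s) (B := fun _ => -c + ε) (B' := fun _ => 0)
      (fun s hs => (hdiff s hs).continuousAt.neg.continuousWithinAt)
      (fun s hs => (hdiff s (Set.Ico_subset_Icc_self hs)).neg.hasDerivWithinAt)
      (by linarith) (fun s => hasDerivAt_const s _) (fun s hs h_eq => ?_) htT
    have h_neg : α (φ s - c) < 0 := by
      rw [← hα0]
      exact hα_mono (by linarith)
    linarith [hineq s (Set.Ico_subset_Icc_self hs)]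
  linarith
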